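/- Let p be a prime, h ≥ 2 an integer, q := p^h with q > 27, and let c be a codeword of the code C_1(2,q). If either (h > 2 and wt(c) ≤ (⌊√q⌋ − 1)(q + 1), where √q denotes the real square root of q) or (h = 2 and wt(c) ≤ (⌊p/4⌋ − 1)(q + 1)), then c is a linear combination of exactly ⌈wt(c)/(q+1)⌉ different lines, i.e. there exist m := ⌈wt(c)/(q+1)⌉ pairwise distinct lines L_1, …, L_m of PG(2,q) and nonzero scalars α_1, …, α_m ∈ ℤ/pℤ with c = α_1·f_{L_1} + … + α_m·f_{L_m}. -/

import Mathlib

open Module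

noncomputable section

/-- `pgTheta q m = 1 + q + … + q^m` for `m ≥ 0`, and `0` for `m < 0`. -/
def pgTheta (q : ℕ) (m : ℤ) : ℤ := ∑ i ∈ Finset.range (m + 1).toNat, (q : ℤ) ^ i

/-- `q^j`, truncated to `0` for negative exponents `j`. -/
def pgQpow (q : ℕ) (j : ℤ) : ℤ := if j < 0 then 0 else (q : ℤ) ^ j.toNat

/-- `Δ_{i,q}` where `q = p^h`: `⌊√q / 2^(i-2)⌋` if `h > 2`, and `⌊p / 2^i⌋` if `h = 2`. -/
noncomputable def pgDelta (p h : ℕ) (i : ℤ) : ℤ :=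
  if 2 < h then ⌊Real.sqrt ((p : ℝ) ^ h) / (2 : ℝ) ^ (i - 2)⌋
  else ⌊(p : ℝ) / (2 : ℝ) ^ i⌋

/-- `W(i,q) = (Δ_{i,q} - 1)·θ_{i-1}`. -/
noncomputable def pgW (p h : ℕ) (i : ℤ) : ℤ := (pgDelta p h i - 1) * pgTheta (p ^ h) (i - 1)

/-- `U(n,i,q) = q^i − (Δ_{n,q} − 2)·⌊q^(i−1)⌋ − (i−2)·((q−1)·Δ_{n,q} + 1)·⌊q^(i−3)⌋ + θ_{i−3}`. -/
noncomputable def pgU (p h n : ℕ) (i : ℤ) : ℤ :=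
  pgQpow (p ^ h) i - (pgDelta p h n - 2) * pgQpow (p ^ h) (i - 1)
    - (i - 2) * ((((p ^ h : ℕ) : ℤ) - 1) * pgDelta p h n + 1) * pgQpow (p ^ h) (i - 3)
    + pgTheta (p ^ h) (i - 3)

/-- `⌈w / θ_m⌉` as a natural number. -/
noncomputable def pgCeil (q w : ℕ) (m : ℤ) : ℕ := (⌈(w : ℚ) / ((pgTheta q m : ℤ) : ℚ)⌉).toNat
open scoped Classical

/-- A point of `PG(n,q)`: a 1-dimensional subspace of `F^(n+1)`. -/
abbrev PGPoint (F : Type) [Field F] (n : ℕ) :=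
  {P : Submodule F (Fin (n + 1) → F) // finrank F P = 1}

/-- The indicator function of a subspace `κ`, with values in `ZMod p`. -/
noncomputable def pgInd (p : ℕ) (F : Type) [Field F] (n : ℕ)
    (κ : Submodule F (Fin (n + 1) → F)) : PGPoint F n → ZMod p :=
  fun P => if P.1 ≤ κ then 1 else 0

/-- The code `C_{n-1}(n,q)`: the `ZMod p`-span of the indicator functions of all
hyperplanes (i.e. `n`-dimensional subspaces of `F^(n+1)`). -/
noncomputable def pgCode (p : ℕ) (F : Type) [Field F] (n : ℕ) :
    Submodule (ZMod p) (PGPoint F n → ZMod p) :=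
  Submodule.span (ZMod p)
    {f | ∃ H : Submodule F (Fin (n + 1) → F), finrank F H = n ∧ f = pgInd p F n H}

/-- The weight of a codeword: the number of points where it is nonzero. -/
noncomputable def pgWt (p : ℕ) (F : Type) [Field F] (n : ℕ)
    (c : PGPoint F n → ZMod p) : ℕ :=
  Set.ncard {P : PGPoint F n | c P ≠ 0}

/-- The number of points of `supp c` lying in the subspace `κ`. -/
noncomputable def pgSecant (p : ℕ) (F : Type) [Field F] (n : ℕ)
    (c : PGPoint F n → ZMod p) (κ : Submodule F (Fin (n + 1) → F)) : ℕ :=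
  Set.ncard {P : PGPoint F n | c P ≠ 0 ∧ P.1 ≤ κ}

/-- A codeword `c` is minimal if every codeword whose support is contained in the
support of `c` is a scalar multiple of `c`. -/
noncomputable def pgMinimal (p : ℕ) (F : Type) [Field F] (n : ℕ)
    (c : PGPoint F n → ZMod p) : Prop :=
  ∀ c' ∈ pgCode p F n, {P : PGPoint F n | c' P ≠ 0} ⊆ {P : PGPoint F n | c P ≠ 0} →
    ∃ α : ZMod p, c' = α • c

open Polynomial Finset in
/-- The Hankel matrix of the power moments `∑ x, x ^ n * w x`. -/
def hankelMatrix {F : Type*} [Field F] [Fintype F] (w : F → F[X]) (m : ℕ) :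
    Matrix (Fin m) (Fin m) F[X] :=
  Matrix.of fun l i => ∑ x, C (x ^ ((l : ℕ) + i)) * w x

section Hankel

open Polynomial Finset

variable {F : Type*} [Field F] [Fintype F]

lemma natDegree_det_hankelMatrix_le (w : F → F[X])
    (hw : ∀ n, (∑ x, C (x ^ n) * w x).natDegree ≤ n) (m : ℕ) :
    (hankelMatrix w m).det.natDegree ≤ m * (m - 1) := by
  rw [Matrix.det_apply']
  refine natDegree_sum_le_of_forall_le _ _ fun σ _ => ?_
  refine natDegree_mul_le.trans ?_
  rw [natDegree_intCast, zero_add]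
  refine (natDegree_prod_le _ _).trans ?_
  calc ∑ i, (hankelMatrix w m (σ i) i).natDegree ≤ ∑ i : Fin m, ((σ i : ℕ) + i) :=
        sum_le_sum fun i _ => hw _
    _ = (∑ i : Fin m, (i : ℕ)) * 2 := by
        rw [sum_add_distrib, Equiv.sum_comp σ (fun i : Fin m => (i : ℕ)), mul_two]
    _ = m * (m - 1) := by
        rw [Fin.sum_univ_eq_sum_range (fun i => i), sum_range_id_mul_two]

lemma det_hankelMatrix (w : F → F[X]) (m : ℕ) :
    (hankelMatrix w m).det = ∑ r : Fin m → F,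
      (∏ l, C (r l ^ (l : ℕ)) * w (r l)) *
        (Matrix.of fun l i : Fin m => C (r l ^ (i : ℕ))).det := by
  have key : hankelMatrix w m = fun l : Fin m => ∑ x : F,
      (C (x ^ (l : ℕ)) * w x) • fun i : Fin m => C (x ^ (i : ℕ)) := by
    ext l i : 1
    rw [Finset.sum_apply]
    refine sum_congr (M := F[X]) rfl fun x _ => ?_
    simp only [Pi.smul_apply, smul_eq_mul, pow_add, C_mul]
    ring
  have := (Matrix.detRowAlternating (n := Fin m) (R := F[X])).toMultilinearMap.map_sum
    (fun (l : Fin m) (x : F) => (C (x ^ (l : ℕ)) * w x) • fun i : Fin m => C (x ^ (i : ℕ)))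
  rw [key]
  refine this.trans (sum_congr rfl fun r _ => ?_)
  exact (Matrix.detRowAlternating (n := Fin m) (R := F[X])).toMultilinearMap.map_smul_univ
    (fun l => C (r l ^ (l : ℕ)) * w (r l)) (fun l i => C (r l ^ (i : ℕ)))

lemma pow_dvd_det_hankelMatrix (w : F → F[X]) (m : ℕ) (y : F) :
    (X - C y) ^ (m - #{x | (w x).eval y ≠ 0}) ∣ (hankelMatrix w m).det := by
  rw [det_hankelMatrix]
  refine dvd_sum fun r _ => ?_
  by_cases hr : Function.Injective r
  · refine Dvd.dvd.mul_right ?_ _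
    rw [prod_mul_distrib]
    refine Dvd.dvd.mul_left ?_ _
    have h1 : (X - C y) ^ #{l | (w (r l)).eval y = 0} ∣ ∏ l, w (r l) := by
      rw [← prod_filter_mul_prod_filter_not univ (fun l => (w (r l)).eval y = 0)]
      refine Dvd.dvd.mul_right ?_ _
      rw [← prod_const]
      refine prod_dvd_prod_of_dvd _ _ fun l hl => ?_
      exact dvd_iff_isRoot.2 (mem_filter.1 hl).2
    refine (pow_dvd_pow _ ?_).trans h1
    have h2 : #{l | ¬ (w (r l)).eval y = 0} ≤ #{x | (w x).eval y ≠ 0} :=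
      card_le_card_of_injOn r (fun l hl => by simpa using hl) hr.injOn
    have h3 := card_filter_add_card_filter_not (s := (univ : Finset (Fin m)))
      (fun l => (w (r l)).eval y = 0)
    rw [card_univ, Fintype.card_fin] at h3
    omega
  · obtain ⟨a, b, hab, hne⟩ : ∃ a b, r a = r b ∧ a ≠ b := by
      simpa [Function.Injective] using hr
    rw [Matrix.det_zero_of_row_eq hne (by ext i : 1; simp [hab]), mul_zero]
    exact dvd_zero _

lemma det_hankelMatrix_ne_zero (w : F → F[X]) (y : F) :
    (hankelMatrix w #{x | (w x).eval y ≠ 0}).det ≠ 0 := by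
  set S : Finset F := {x | (w x).eval y ≠ 0}
  intro h0
  have h1 : ((hankelMatrix w #S).map (evalRingHom y)).det = 0 := by
    rw [← RingHom.mapMatrix_apply, ← RingHom.map_det, h0, map_zero]
  let e : Fin #S ≃ S := S.equivFin.symm
  let V := Matrix.vandermonde fun i => (e i : F)
  have h2 : (hankelMatrix w #S).map (evalRingHom y) =
      V.transpose * Matrix.diagonal (fun i => (w (e i)).eval y) * V := by
    ext l i
    rw [Matrix.mul_apply]
    simp only [Matrix.mul_diagonal, Matrix.transpose_apply, V, Matrix.vandermonde_apply,
      Matrix.map_apply, hankelMatrix, Matrix.of_apply, coe_evalRingHom, eval_finsetSum, eval_mul,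
      eval_C]
    rw [Equiv.sum_comp e (fun x : S => (x : F) ^ (l : ℕ) * (w x).eval y * (x : F) ^ (i : ℕ)),
      sum_coe_sort S (fun x : F => x ^ (l : ℕ) * (w x).eval y * x ^ (i : ℕ))]
    symm
    refine sum_subset_zero_on_sdiff (subset_univ _) (fun x hx => ?_) (fun x _ => by ring)
    have : (w x).eval y = 0 := by simpa [S] using hx
    rw [this, mul_zero]
  rw [h2, Matrix.det_mul, Matrix.det_mul, Matrix.det_transpose, Matrix.det_diagonal] at h1
  have hV : V.det ≠ 0 :=
    Matrix.det_vandermonde_ne_zero_iff.2 (Subtype.val_injective.comp e.injective)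
  have hD : ∏ i, (w (e i)).eval y ≠ 0 := prod_ne_zero_iff.2 fun i _ => (mem_filter.1 (e i).2).2
  exact mul_ne_zero (mul_ne_zero hV hD) hV h1

/-- If the power moments `∑ x, x ^ n * w x` have degree at most `n`, then the number of points
`x` with `w x y ≠ 0` drops below its value at `y₀` by a bounded total amount. -/
lemma sum_card_sub_card_le (w : F → F[X])
    (hw : ∀ n, (∑ x, C (x ^ n) * w x).natDegree ≤ n) (y₀ : F) :
    ∑ y, (#{x | (w x).eval y₀ ≠ 0} - #{x | (w x).eval y ≠ 0}) ≤
      #{x | (w x).eval y₀ ≠ 0} * (#{x | (w x).eval y₀ ≠ 0} - 1) := by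
  set m := #{x | (w x).eval y₀ ≠ 0}
  have hdvd : ∏ y, (X - C y) ^ (m - #{x | (w x).eval y ≠ 0}) ∣ (hankelMatrix w m).det :=
    prod_dvd_of_coprime
      (fun a _ b _ hab => (pairwise_coprime_X_sub_C Function.injective_id hab).pow)
      (fun y _ => pow_dvd_det_hankelMatrix w m y)
  have := (natDegree_le_of_dvd hdvd (det_hankelMatrix_ne_zero w y₀)).trans
    (natDegree_det_hankelMatrix_le w hw m)
  rwa [natDegree_prod _ _ (fun y _ => pow_ne_zero _ (X_sub_C_ne_zero y)),
    sum_congr rfl (fun y _ => by rw [natDegree_pow, natDegree_X_sub_C, mul_one])] at this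

lemma sum_eval_eq_zero_of_natDegree_lt (P : F[X]) (hP : P.natDegree < Fintype.card F - 1) :
    ∑ x, P.eval x = 0 := by
  simp_rw [eval_eq_sum_range]
  rw [sum_comm]
  refine sum_eq_zero fun i hi => ?_
  rw [← mul_sum, FiniteField.sum_pow_lt_card_sub_one, mul_zero]
  have := mem_range.1 hi
  omega

lemma natDegree_moment_linear_pow_le (a b c : F) (n : ℕ) :
    (∑ x, C (x ^ n) *
      (1 - (C (a * x + c) + C b * X) ^ (Fintype.card F - 1))).natDegree ≤ n := by
  rw [natDegree_le_iff_coeff_eq_zero]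
  intro N hN
  set m := Fintype.card F - 1
  have hcoeff : ∀ d : F, ((C d + C b * X) ^ m).coeff N = d ^ (m - N) * (b ^ N * m.choose N) := by
    intro d
    have : (C d + C b * X) ^ m = ((X + C d) ^ m).comp (C b * X) := by simp [add_comm]
    rw [this, comp_C_mul_X_coeff, coeff_X_add_C_pow]
    ring
  simp only [finsetSum_coeff, coeff_C_mul, coeff_sub, hcoeff, coeff_one,
    if_neg (by omega : ¬ N = 0), zero_sub, mul_neg, sum_neg_distrib, neg_eq_zero]
  rcases lt_or_ge m N with h | h
  · simp [Nat.choose_eq_zero_of_lt h]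
  · have h1 := sum_eval_eq_zero_of_natDegree_lt
      (X ^ n * (C a * X + C c) ^ (m - N)) (by
        refine lt_of_le_of_lt natDegree_mul_le ?_
        have h2 : ((C a * X + C c) ^ (m - N)).natDegree ≤ (m - N) * 1 :=
          natDegree_pow_le_of_le _ natDegree_linear_le
        rw [natDegree_X_pow]
        change n + _ < m
        omega)
    simp only [eval_mul, eval_pow, eval_X, eval_add, eval_C] at h1
    simp_rw [← mul_assoc, ← sum_mul]
    rw [h1, zero_mul, zero_mul]

end Hankel

section Geometry

variable {F : Type} [Field F]

/-- The point of the projective plane spanned by a nonzero vector. -/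
def pgPt (v : Fin 3 → F) (hv : v ≠ 0) : PGPoint F 2 :=
  ⟨F ∙ v, finrank_span_singleton hv⟩

lemma exists_eq_pgPt (P : PGPoint F 2) : ∃ v, ∃ hv : v ≠ 0, P = pgPt v hv := by
  obtain ⟨v, hv, hP⟩ := finrank_eq_one_iff'.1 P.2
  refine ⟨v, by simpa using hv, Subtype.ext (le_antisymm (fun w hw => ?_) ?_)⟩
  · obtain ⟨a, ha⟩ := hP ⟨w, hw⟩
    exact Submodule.mem_span_singleton.2 ⟨a, congrArg Subtype.val ha⟩
  · exact (Submodule.span_singleton_le_iff_mem _ _).2 v.2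

lemma pgPt_le_iff {v : Fin 3 → F} {hv : v ≠ 0} {κ : Submodule F (Fin 3 → F)} :
    (pgPt v hv).1 ≤ κ ↔ v ∈ κ :=
  Submodule.span_singleton_le_iff_mem _ _

lemma pgPt_eq_of_smul_eq {v w : Fin 3 → F} {hv : v ≠ 0} {hw : w ≠ 0} (a : F) (h : a • w = v) :
    pgPt v hv = pgPt w hw := by
  refine Subtype.ext (Submodule.eq_of_le_of_finrank_eq ?_ ?_)
  · exact pgPt_le_iff.2 (Submodule.mem_span_singleton.2 ⟨a, h⟩)
  · rw [(pgPt v hv).2, (pgPt w hw).2]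

lemma PGPoint.eq_of_le {P Q : PGPoint F 2} (h : P.1 ≤ Q.1) : P = Q :=
  Subtype.ext (Submodule.eq_of_le_of_finrank_eq h (P.2.trans Q.2.symm))

lemma finrank_sup_of_ne {P Q : PGPoint F 2} (h : P ≠ Q) :
    finrank F (P.1 ⊔ Q.1 : Submodule F (Fin 3 → F)) = 2 := by
  have h1 := Submodule.finrank_sup_add_finrank_inf_eq P.1 Q.1
  have h2 : finrank F (P.1 ⊓ Q.1 : Submodule F (Fin 3 → F)) < 1 := by
    by_contra! hle
    have h3 : P.1 ⊓ Q.1 = P.1 :=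
      Submodule.eq_of_le_of_finrank_le inf_le_left (by rw [P.2]; exact hle)
    exact h (PGPoint.eq_of_le (inf_eq_left.1 h3))
  rw [P.2, Q.2, Nat.lt_one_iff.1 h2] at h1
  exact h1

lemma finrank_inf_lines_le_one {L M : Submodule F (Fin 3 → F)} (hL : finrank F L = 2)
    (hM : finrank F M = 2) (h : L ≠ M) : finrank F (L ⊓ M : Submodule F (Fin 3 → F)) ≤ 1 := by
  by_contra! hlt
  have h1 : L ⊓ M = L := Submodule.eq_of_le_of_finrank_le inf_le_left (by omega)
  exact h (Submodule.eq_of_le_of_finrank_eq (inf_eq_left.1 h1) (hL.trans hM.symm))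

lemma PGPoint.eq_of_le_lines {L M : Submodule F (Fin 3 → F)} (hL : finrank F L = 2)
    (hM : finrank F M = 2) (h : L ≠ M) {P Q : PGPoint F 2} (hPL : P.1 ≤ L) (hPM : P.1 ≤ M)
    (hQL : Q.1 ≤ L) (hQM : Q.1 ≤ M) : P = Q := by
  by_contra hPQ
  have h1 := Submodule.finrank_mono (sup_le (le_inf hPL hPM) (le_inf hQL hQM))
  rw [finrank_sup_of_ne hPQ] at h1
  exact absurd (h1.trans (finrank_inf_lines_le_one hL hM h)) (by norm_num)

/-- A frame adapted to an incident point-line pair. -/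
lemma exists_basis_of_flag {P : PGPoint F 2} {L : Submodule F (Fin 3 → F)}
    (hL : finrank F L = 2) (hP : P.1 ≤ L) :
    ∃ b : Basis (Fin 3) F (Fin 3 → F), P.1 = F ∙ b 2 ∧ L = Submodule.span F {b 1, b 2} := by
  obtain ⟨u, hu, rfl⟩ := exists_eq_pgPt P
  have huL : u ∈ L := pgPt_le_iff.1 hP
  obtain ⟨w, hwL, hw⟩ : ∃ w ∈ L, w ∉ F ∙ u := by
    by_contra! h
    have := Submodule.finrank_mono (show L ≤ F ∙ u from h)
    rw [finrank_span_singleton hu] at this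
    omega
  obtain ⟨v, hv⟩ : ∃ v, v ∉ L := by
    by_contra! h
    have : L = ⊤ := (Submodule.eq_top_iff').2 h
    rw [this, finrank_top] at hL
    simp at hL
  have h2 : LinearIndependent F ![w, u] := by
    refine linearIndependent_finCons.2 ⟨?_, by simpa using hw⟩
    exact LinearIndependent.of_subsingleton 0 (by simpa using hu)
  have hspan : L = Submodule.span F {w, u} := by
    symm
    refine Submodule.eq_of_le_of_finrank_eq ?_ ?_
    · rw [Submodule.span_le]
      rintro x (rfl | rfl) <;> assumption
    · have := finrank_span_eq_card h2
      rw [Matrix.range_cons, Matrix.range_cons, Matrix.range_empty, Set.union_empty,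
        Set.singleton_union] at this
      rw [this, hL, Fintype.card_fin]
  have h3 : LinearIndependent F ![v, w, u] := by
    refine linearIndependent_finCons.2 ⟨h2, ?_⟩
    simpa [hspan, Set.pair_comm] using hv
  let b := basisOfLinearIndependentOfCardEqFinrank h3 (by simp)
  have hb : ⇑b = ![v, w, u] := coe_basisOfLinearIndependentOfCardEqFinrank h3 _
  refine ⟨b, ?_, ?_⟩
  · simp [hb, pgPt]
  · simpa [hb] using hspan

lemma pgAff_ne_zero (b : Basis (Fin 3) F (Fin 3 → F)) (x y : F) :
    x • b 2 + y • b 0 + b 1 ≠ 0 := by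
  intro h
  have := congrArg (fun v => b.repr v 1) h
  simp at this

/-- The point with affine coordinates `(x, y)` with respect to a frame. -/
def pgAff (b : Basis (Fin 3) F (Fin 3 → F)) (x y : F) : PGPoint F 2 :=
  pgPt (x • b 2 + y • b 0 + b 1) (pgAff_ne_zero b x y)

lemma pgAff_injective (b : Basis (Fin 3) F (Fin 3 → F)) {x y x' y' : F}
    (h : pgAff b x y = pgAff b x' y') : x = x' ∧ y = y' := by
  have h1 : (pgAff b x y).1 ≤ (pgAff b x' y').1 := h ▸ le_rfl
  obtain ⟨a, ha⟩ := Submodule.mem_span_singleton.1 (pgPt_le_iff.1 h1)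
  have h0 := congrArg (fun v => b.repr v 0) ha
  have h1 := congrArg (fun v => b.repr v 1) ha
  have h2 := congrArg (fun v => b.repr v 2) ha
  simp at h0 h1 h2
  subst h1
  simp_all

lemma pgAff_zero_le (b : Basis (Fin 3) F (Fin 3 → F)) (x : F) :
    (pgAff b x 0).1 ≤ Submodule.span F {b 1, b 2} := by
  refine pgPt_le_iff.2 (Submodule.mem_span_pair.2 ⟨1, x, ?_⟩)
  rw [zero_smul, one_smul, add_zero, add_comm]

lemma exists_eq_pgAff_zero (b : Basis (Fin 3) F (Fin 3 → F)) {Q : PGPoint F 2}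
    (hQ : Q.1 ≤ Submodule.span F {b 1, b 2}) (hne : Q.1 ≠ F ∙ b 2) :
    ∃ x, Q = pgAff b x 0 := by
  obtain ⟨v, hv, rfl⟩ := exists_eq_pgPt Q
  obtain ⟨r, s, rfl⟩ := Submodule.mem_span_pair.1 (pgPt_le_iff.1 hQ)
  have hr : r ≠ 0 := by
    rintro rfl
    refine hne (congrArg Subtype.val (pgPt_eq_of_smul_eq (hw := b.ne_zero 2) s ?_))
    rw [zero_smul, zero_add]
  refine ⟨s / r, pgPt_eq_of_smul_eq r ?_⟩
  rw [zero_smul, add_zero, smul_add, smul_smul, mul_div_cancel₀ _ hr, add_comm]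

lemma exists_dual_ker_eq {H : Submodule F (Fin 3 → F)} (hH : finrank F H = 2) :
    ∃ φ : Dual F (Fin 3 → F), LinearMap.ker φ = H := by
  have hlt : H < ⊤ := by
    rw [lt_top_iff_ne_top]
    rintro rfl
    simp at hH
  obtain ⟨φ, hφ, hle⟩ := Submodule.exists_le_ker_of_lt_top H hlt
  refine ⟨φ, (Submodule.eq_of_le_of_finrank_eq hle ?_).symm⟩
  have := Module.Dual.finrank_ker_add_one_of_ne_zero hφ
  simp at this
  omega

variable [Fintype F]

lemma card_points_on_line {L : Submodule F (Fin 3 → F)} (hL : finrank F L = 2) :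
    {P : PGPoint F 2 | P.1 ≤ L}.ncard = Fintype.card F + 1 := by
  obtain ⟨u, hu⟩ : ∃ u : L, u ≠ 0 := by
    have : Nontrivial L := Module.nontrivial_of_finrank_pos (R := F) (by omega)
    exact exists_ne 0
  have hu' : (u : Fin 3 → F) ≠ 0 := by simpa using hu
  let P := pgPt (u : Fin 3 → F) hu'
  have hP : P.1 ≤ L := pgPt_le_iff.2 u.2
  obtain ⟨b, hbP, hbL⟩ := exists_basis_of_flag hL hP
  have hset : {P : PGPoint F 2 | P.1 ≤ L} = insert P (Set.range fun x => pgAff b x 0) := by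
    ext Q
    constructor
    · intro hQ
      by_cases h : Q = P
      · exact Or.inl h
      · obtain ⟨x, hx⟩ := exists_eq_pgAff_zero b (hbL ▸ hQ : Q.1 ≤ _)
          (fun h' => h (Subtype.ext (h'.trans hbP.symm)))
        exact Or.inr ⟨x, hx.symm⟩
    · rintro (rfl | ⟨x, rfl⟩)
      · exact hP
      · exact hbL ▸ pgAff_zero_le b x
  have hnot : P ∉ Set.range fun x => pgAff b x 0 := by
    rintro ⟨x, hx⟩
    have h1 : (pgAff b x 0).1 ≤ F ∙ b 2 := by rw [← hbP, ← hx]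
    obtain ⟨a, ha⟩ := Submodule.mem_span_singleton.1 (pgPt_le_iff.1 h1)
    have := congrArg (fun v => b.repr v 1) ha
    simp at this
  rw [hset, Set.ncard_insert_of_notMem hnot (Set.toFinite _),
    Set.ncard_range_of_injective fun x y hxy => (pgAff_injective b hxy).1,
    Nat.card_eq_fintype_card]

end Geometry

section Code

open Polynomial Finset

variable {F : Type} [Field F] [Fintype F] {p : ℕ}

lemma sum_card_pgAff_le_pgWt (b : Basis (Fin 3) F (Fin 3 → F)) (c : PGPoint F 2 → ZMod p) :
    ∑ y, #{x | c (pgAff b x y) ≠ 0} ≤ pgWt p F 2 c := by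
  have h1 : ∑ y, #{x | c (pgAff b x y) ≠ 0} = #{z : F × F | c (pgAff b z.2 z.1) ≠ 0} := by
    simp_rw [card_filter]
    rw [← univ_product_univ, sum_product]
  rw [h1, pgWt, ← Set.ncard_coe_finset]
  refine Set.ncard_le_ncard_of_injOn (fun z => pgAff b z.2 z.1) (fun z hz => by simpa using hz)
    ?_ (Set.toFinite _)
  rintro ⟨y, x⟩ - ⟨y', x'⟩ - h
  obtain ⟨rfl, rfl⟩ := pgAff_injective b h
  rfl

variable [Fact p.Prime] [CharP F p]

lemma pgInd_pgAff (b : Basis (Fin 3) F (Fin 3 → F)) (φ : Dual F (Fin 3 → F)) (x y : F) :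
    (1 - (C (φ (b 2) * x + φ (b 1)) + C (φ (b 0)) * X) ^ (Fintype.card F - 1)).eval y =
      ZMod.castHom (dvd_refl p) F (pgInd p F 2 (LinearMap.ker φ) (pgAff b x y)) := by
  have hval : φ (x • b 2 + y • b 0 + b 1) = φ (b 2) * x + φ (b 1) + φ (b 0) * y := by
    simp only [map_add, map_smul, smul_eq_mul]
    ring
  have hmem : (pgAff b x y).1 ≤ LinearMap.ker φ ↔ φ (b 2) * x + φ (b 1) + φ (b 0) * y = 0 := by
    rw [← hval]
    exact pgPt_le_iff
  simp only [eval_sub, eval_one, eval_pow, eval_add, eval_C, eval_mul, eval_X, pgInd, hmem]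
  split_ifs with h
  · have : Fintype.card F - 1 ≠ 0 := by
      have := Fintype.one_lt_card (α := F)
      omega
    rw [h, zero_pow this, sub_zero, map_one]
  · rw [FiniteField.pow_card_sub_one_eq_one _ h, sub_self, map_zero]

/-- In affine coordinates a codeword is given by polynomials whose power moments have small
degree. -/
lemma exists_polynomial_of_mem_pgCode (b : Basis (Fin 3) F (Fin 3 → F))
    {c : PGPoint F 2 → ZMod p} (hc : c ∈ pgCode p F 2) :
    ∃ w : F → F[X], (∀ n, (∑ x, C (x ^ n) * w x).natDegree ≤ n) ∧
      ∀ x y, (w x).eval y = ZMod.castHom (dvd_refl p) F (c (pgAff b x y)) := by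
  induction hc using Submodule.span_induction with
  | mem f hf =>
    obtain ⟨H, hH, rfl⟩ := hf
    obtain ⟨φ, rfl⟩ := exists_dual_ker_eq hH
    exact ⟨_, fun n => natDegree_moment_linear_pow_le (φ (b 2)) (φ (b 0)) (φ (b 1)) n,
      fun x y => pgInd_pgAff b φ x y⟩
  | zero => exact ⟨0, by simp, by simp⟩
  | add f g _ _ hf hg =>
    obtain ⟨w, hw, hwf⟩ := hf
    obtain ⟨w', hw', hwg⟩ := hg
    refine ⟨w + w', fun n => ?_, fun x y => ?_⟩
    · simp only [Pi.add_apply, mul_add, sum_add_distrib]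
      exact natDegree_add_le_of_degree_le (hw n) (hw' n)
    · rw [Pi.add_apply, eval_add, hwf, hwg, Pi.add_apply, map_add]
  | smul a f _ hf =>
    obtain ⟨w, hw, hwf⟩ := hf
    refine ⟨fun x => C (ZMod.castHom (dvd_refl p) F a) * w x, fun n => ?_, fun x y => ?_⟩
    · have : ∑ x, C (x ^ n) * (C (ZMod.castHom (dvd_refl p) F a) * w x) =
          C (ZMod.castHom (dvd_refl p) F a) * ∑ x, C (x ^ n) * w x := by
        rw [mul_sum]
        exact sum_congr rfl fun x _ => by ring
      rw [this]
      exact (natDegree_C_mul_le _ _).trans (hw n)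
    · rw [eval_mul, eval_C, hwf, Pi.smul_apply, smul_eq_mul, map_mul]

/-- The secant inequality: a line meets the support of a codeword in few or in many points. -/
theorem card_add_one_mul_pgSecant_le {c : PGPoint F 2 → ZMod p} (hc : c ∈ pgCode p F 2)
    {L : Submodule F (Fin 3 → F)} (hL : finrank F L = 2) :
    (Fintype.card F + 1) * pgSecant p F 2 c L ≤ pgWt p F 2 c + pgSecant p F 2 c L ^ 2 := by
  by_cases hall : ∀ P : PGPoint F 2, P.1 ≤ L → c P ≠ 0
  · have : pgSecant p F 2 c L = Fintype.card F + 1 := by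
      rw [← card_points_on_line hL, pgSecant]
      congr 1
      ext P
      exact ⟨fun h => h.2, fun h => ⟨hall P h, h⟩⟩
    rw [this, sq]
    exact Nat.le_add_left _ _
  push Not at hall
  obtain ⟨P, hPL, hcP⟩ := hall
  obtain ⟨b, hbP, hbL⟩ := exists_basis_of_flag hL hPL
  obtain ⟨w, hw, hwc⟩ := exists_polynomial_of_mem_pgCode b hc
  have hne : ∀ x y, (w x).eval y ≠ 0 ↔ c (pgAff b x y) ≠ 0 := fun x y => by
    rw [hwc, map_ne_zero_iff _ (ZMod.castHom (dvd_refl p) F).injective]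
  have hs : pgSecant p F 2 c L = #{x | c (pgAff b x 0) ≠ 0} := by
    rw [pgSecant, ← Set.ncard_coe_finset, ← Set.ncard_image_of_injective _
      (fun x x' h => (pgAff_injective b h).1 : Function.Injective fun x => pgAff b x 0)]
    congr 1
    ext Q
    constructor
    · rintro ⟨hQ, hQL⟩
      obtain ⟨x, rfl⟩ := exists_eq_pgAff_zero b (hbL ▸ hQL) fun h =>
        hQ ((Subtype.ext (h.trans hbP.symm) : Q = P) ▸ hcP)
      exact ⟨x, by simpa using hQ, rfl⟩
    · rintro ⟨x, hx, rfl⟩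
      exact ⟨by simpa using hx, hbL ▸ pgAff_zero_le b x⟩
  have h1 := sum_card_sub_card_le w hw 0
  simp_rw [hne, ← hs] at h1
  set s := pgSecant p F 2 c L
  have h2 : Fintype.card F * s ≤
      ∑ y, #{x | c (pgAff b x y) ≠ 0} + ∑ y, (s - #{x | c (pgAff b x y) ≠ 0}) := by
    rw [← sum_add_distrib, ← smul_eq_mul, ← card_univ, ← sum_const]
    exact sum_le_sum fun y _ => by omega
  have h3 := sum_card_pgAff_le_pgWt b c
  have h4 : s * (s - 1) + s = s ^ 2 := by
    cases s with
    | zero => rfl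
    | succ n => rw [Nat.add_sub_cancel]; ring
  rw [add_mul, one_mul]
  omega

end Code

section Counting

open Finset

variable {F : Type} [Field F]

lemma exists_line_not_through (P : PGPoint F 2) :
    ∃ M : Submodule F (Fin 3 → F), finrank F M = 2 ∧ ¬ P.1 ≤ M := by
  obtain ⟨M, hM⟩ := Submodule.exists_isCompl P.1
  have h1 := Submodule.finrank_add_eq_of_isCompl hM
  rw [P.2, finrank_fin_fun, add_comm] at h1
  refine ⟨M, Nat.succ_injective h1, fun h => ?_⟩
  have h2 := P.2
  rw [disjoint_self.1 (hM.disjoint.mono_right h), finrank_bot] at h2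
  exact zero_ne_one h2

lemma exists_le_join {P Q : PGPoint F 2} (hPQ : Q ≠ P) {M : Submodule F (Fin 3 → F)}
    (hM : finrank F M = 2) (hP : ¬ P.1 ≤ M) :
    ∃ R : PGPoint F 2, R.1 ≤ M ∧ Q.1 ≤ P.1 ⊔ R.1 := by
  have h1 := Submodule.finrank_sup_add_finrank_inf_eq (P.1 ⊔ Q.1) M
  have h2 := Submodule.finrank_le (P.1 ⊔ Q.1 ⊔ M)
  rw [finrank_sup_of_ne hPQ.symm, hM] at h1
  rw [finrank_fin_fun] at h2
  have h3 : 0 < finrank F ((P.1 ⊔ Q.1) ⊓ M : Submodule F (Fin 3 → F)) := by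
    by_contra! h
    rw [Nat.le_zero.1 h] at h1
    exact absurd (h1.symm.le.trans h2) (by norm_num)
  have : Nontrivial ((P.1 ⊔ Q.1) ⊓ M : Submodule F (Fin 3 → F)) :=
    Module.nontrivial_of_finrank_pos h3
  obtain ⟨v, hv⟩ := exists_ne (0 : ((P.1 ⊔ Q.1) ⊓ M : Submodule F (Fin 3 → F)))
  have hv0 : (v : Fin 3 → F) ≠ 0 := by simpa using hv
  let R := pgPt (v : Fin 3 → F) hv0
  have hRM : R.1 ≤ M := pgPt_le_iff.2 v.2.2
  have hRPQ : R.1 ≤ P.1 ⊔ Q.1 := pgPt_le_iff.2 v.2.1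
  have hPR : P ≠ R := fun h => hP (h ▸ hRM)
  refine ⟨R, hRM, ?_⟩
  rw [Submodule.eq_of_le_of_finrank_eq (sup_le le_sup_left hRPQ)
    ((finrank_sup_of_ne hPR).trans (finrank_sup_of_ne hPQ.symm).symm)]
  exact le_sup_right

variable [Fintype F] {p : ℕ}

lemma pgWt_le_of_pgSecant_le {c : PGPoint F 2 → ZMod p} {P : PGPoint F 2} (hP : c P ≠ 0) {n : ℕ}
    (h : ∀ L : Submodule F (Fin 3 → F), finrank F L = 2 → P.1 ≤ L →
      pgSecant p F 2 c L ≤ n + 1) :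
    pgWt p F 2 c ≤ (Fintype.card F + 1) * n + 1 := by
  have := Fintype.ofFinite (PGPoint F 2)
  obtain ⟨M, hM, hPM⟩ := exists_line_not_through P
  let A : PGPoint F 2 → Finset (PGPoint F 2) := fun R => {Q | c Q ≠ 0 ∧ Q.1 ≤ P.1 ⊔ R.1 ∧ Q ≠ P}
  have hA : ∀ R ∈ ({R | R.1 ≤ M} : Finset (PGPoint F 2)), #(A R) ≤ n := by
    intro R hR
    have hPR : P ≠ R := by
      rintro rfl
      exact hPM (by simpa using hR)
    have h1 := h _ (finrank_sup_of_ne hPR) le_sup_left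
    have h2 : {Q : PGPoint F 2 | c Q ≠ 0 ∧ Q.1 ≤ P.1 ⊔ R.1} =
        (insert P (A R) : Finset (PGPoint F 2)) := by
      ext Q
      by_cases hQ : Q = P
      · subst hQ; simp [hP]
      · simp [A, hQ]
    rw [pgSecant, h2, Set.ncard_coe_finset, card_insert_of_notMem (by simp [A])] at h1
    omega
  have h1 := card_biUnion_le_card_mul _ A n hA
  have h2 : #({R | R.1 ≤ M} : Finset (PGPoint F 2)) = Fintype.card F + 1 := by
    rw [← card_points_on_line hM, ← Set.ncard_coe_finset]
    simp
  rw [h2] at h1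
  have h3 : {Q : PGPoint F 2 | c Q ≠ 0} ⊆
      (insert P (({R | R.1 ≤ M} : Finset (PGPoint F 2)).biUnion A) : Finset (PGPoint F 2)) := by
    intro Q hQ
    by_cases hQP : Q = P
    · simp [hQP]
    · obtain ⟨R, hRM, hQR⟩ := exists_le_join hQP hM hPM
      have hQ' : c Q ≠ 0 := hQ
      simp only [coe_insert, coe_biUnion, Set.mem_insert_iff, Set.mem_iUnion]
      exact Or.inr ⟨R, by simpa using hRM, by simp [A, hQ', hQR, hQP]⟩
  calc pgWt p F 2 c ≤ _ := Set.ncard_le_ncard h3 (Set.toFinite _)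
    _ ≤ _ := by
      rw [Set.ncard_coe_finset]
      exact (card_insert_le _ _).trans (Nat.add_le_add_right h1 1)

lemma exists_line_pgSecant_large [Fact p.Prime] [CharP F p] {c : PGPoint F 2 → ZMod p}
    (hc : c ∈ pgCode p F 2) (hc0 : c ≠ 0) {k : ℕ} (hk : (k + 1) ^ 2 ≤ Fintype.card F)
    (hwt : pgWt p F 2 c ≤ k * (Fintype.card F + 1)) :
    ∃ L : Submodule F (Fin 3 → F), finrank F L = 2 ∧
      Fintype.card F + 1 ≤ pgSecant p F 2 c L + k := by
  obtain ⟨P, hP⟩ := Function.ne_iff.1 hc0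
  rw [Pi.zero_apply] at hP
  obtain ⟨Q, hQ⟩ : ∃ Q : PGPoint F 2, P ≠ Q := by
    obtain ⟨M, hM, hPM⟩ := exists_line_not_through P
    have : {R : PGPoint F 2 | R.1 ≤ M}.ncard ≠ 0 := by rw [card_points_on_line hM]; omega
    obtain ⟨R, hR⟩ := Set.nonempty_of_ncard_ne_zero this
    exact ⟨R, fun h => hPM (h ▸ hR)⟩
  obtain ⟨L, ⟨hL, hPL⟩, hmax⟩ := Set.exists_max_image
    {L : Submodule F (Fin 3 → F) | finrank F L = 2 ∧ P.1 ≤ L} (pgSecant p F 2 c)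
    (Set.toFinite _) ⟨P.1 ⊔ Q.1, finrank_sup_of_ne hQ, le_sup_left⟩
  refine ⟨L, hL, ?_⟩
  have hpos : 0 < pgSecant p F 2 c L := (Set.ncard_pos (Set.toFinite _)).2 ⟨P, hP, hPL⟩
  obtain ⟨n, hn⟩ := Nat.exists_eq_add_of_lt hpos
  rw [zero_add] at hn
  have h1 := pgWt_le_of_pgSecant_le hP (n := n) fun L' h h' => hn ▸ hmax L' ⟨h, h'⟩
  have h2 := card_add_one_mul_pgSecant_le hc hL
  rw [hn] at h2 ⊢
  by_contra! hlt
  by_cases hnk : n + 1 ≤ k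
  · nlinarith
  · push Not at hnk
    obtain ⟨a, rfl⟩ := Nat.exists_eq_add_of_le (Nat.lt_succ_iff.1 hnk)
    obtain ⟨d, hd⟩ := Nat.exists_eq_add_of_lt hlt
    have hd' : Fintype.card F = k + a + k + 1 + d := by omega
    rw [hd'] at h2 hwt hk
    nlinarith [Nat.zero_le (a * d)]

lemma exists_frequent_value [Fact p.Prime] {c : PGPoint F 2 → ZMod p}
    {L : Submodule F (Fin 3 → F)} {k : ℕ} (hk : p * k ≤ Fintype.card F)
    (hs : Fintype.card F + 1 ≤ pgSecant p F 2 c L + k) :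
    ∃ r : ZMod p, r ≠ 0 ∧ k < {Q : PGPoint F 2 | c Q = r ∧ Q.1 ≤ L}.ncard := by
  have := Fintype.ofFinite (PGPoint F 2)
  let S : Finset (PGPoint F 2) := {Q | c Q ≠ 0 ∧ Q.1 ≤ L}
  have hS : pgSecant p F 2 c L = #S := by
    rw [pgSecant, ← Set.ncard_coe_finset]
    simp [S]
  have hp := (Fact.out : p.Prime).one_lt
  have hcard : #(univ.erase (0 : ZMod p)) * k < #S := by
    rw [card_erase_of_mem (mem_univ _), card_univ, ZMod.card, Nat.sub_mul, one_mul]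
    have : k ≤ p * k := Nat.le_mul_of_pos_left _ (by omega)
    omega
  obtain ⟨r, hr, hlt⟩ := exists_lt_card_fiber_of_mul_lt_card_of_maps_to (f := c)
    (fun Q hQ => by simpa using (mem_filter.1 hQ).2.1) hcard
  have hr0 : r ≠ 0 := ne_of_mem_erase hr
  refine ⟨r, hr0, hlt.trans_le ?_⟩
  rw [← Set.ncard_coe_finset]
  refine Set.ncard_le_ncard (fun Q hQ => ?_) (Set.toFinite _)
  have hQ' := mem_filter.1 hQ
  exact ⟨hQ'.2, (mem_filter.1 hQ'.1).2.2⟩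

lemma pgWt_sub_smul_pgInd_lt {c : PGPoint F 2 → ZMod p}
    {L : Submodule F (Fin 3 → F)} (hL : finrank F L = 2) {k : ℕ}
    (hs : Fintype.card F + 1 ≤ pgSecant p F 2 c L + k) {r : ZMod p} (hr : r ≠ 0)
    (hlt : k < {Q : PGPoint F 2 | c Q = r ∧ Q.1 ≤ L}.ncard) :
    pgWt p F 2 (c - r • pgInd p F 2 L) < pgWt p F 2 c := by
  set A := {Q : PGPoint F 2 | c Q = r ∧ Q.1 ≤ L}
  set B := {Q : PGPoint F 2 | c Q ≠ 0}
  set Z := {Q : PGPoint F 2 | c Q = 0 ∧ Q.1 ≤ L}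
  have hAB : A ⊆ B := fun Q hQ => show c Q ≠ 0 from hQ.1 ▸ hr
  have h1 : {Q : PGPoint F 2 | (c - r • pgInd p F 2 L) Q ≠ 0} ⊆ (B \ A) ∪ Z := by
    intro Q hQ
    by_cases hQL : Q.1 ≤ L
    · by_cases hcQ : c Q = 0
      · exact Or.inr ⟨hcQ, hQL⟩
      · refine Or.inl ⟨hcQ, fun h => hQ ?_⟩
        simp [pgInd, hQL, h.1]
    · refine Or.inl ⟨fun h => hQ ?_, fun h => hQL h.2⟩
      simp [pgInd, hQL, h]
  have h2 := (Set.ncard_le_ncard h1 (Set.toFinite _)).trans (Set.ncard_union_le _ _)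
  have h3 := Set.ncard_sdiff_add_ncard_of_subset hAB (Set.toFinite _)
  have h4 : Z.ncard + pgSecant p F 2 c L = Fintype.card F + 1 := by
    rw [← card_points_on_line hL, pgSecant, ← Set.ncard_union_eq ?_ (Set.toFinite _)
      (Set.toFinite _)]
    · congr 1
      ext Q
      simp only [Z, Set.mem_union, Set.mem_ofPred_eq]
      tauto
    · exact Set.disjoint_left.2 fun Q hQ hQ' => hQ'.1 hQ.1
  change Set.ncard _ < B.ncard
  omega

end Counting

section Combination

open Finset

variable {F : Type} [Field F] {p : ℕ}

lemma linearCombination_pgInd_apply (a : Submodule F (Fin 3 → F) →₀ ZMod p) (P : PGPoint F 2) :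
    Finsupp.linearCombination (ZMod p) (pgInd p F 2) a P =
      ∑ L ∈ a.support, a L * pgInd p F 2 L P := by
  rw [Finsupp.linearCombination_apply, Finsupp.sum, Finset.sum_apply]
  rfl

variable [Fintype F]

lemma pgWt_linearCombination_le (a : Submodule F (Fin 3 → F) →₀ ZMod p)
    (ha : ∀ L ∈ a.support, finrank F L = 2) :
    pgWt p F 2 (Finsupp.linearCombination (ZMod p) (pgInd p F 2) a) ≤
      #a.support * (Fintype.card F + 1) := by
  have := Fintype.ofFinite (PGPoint F 2)
  let A : Submodule F (Fin 3 → F) → Finset (PGPoint F 2) := fun L => {P | P.1 ≤ L}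
  have hA : ∀ L ∈ a.support, #(A L) ≤ Fintype.card F + 1 := fun L hL => by
    rw [← card_points_on_line (ha L hL), ← Set.ncard_coe_finset]
    simp [A]
  refine le_trans ?_ (card_biUnion_le_card_mul _ A _ hA)
  rw [pgWt, ← Set.ncard_coe_finset]
  refine Set.ncard_le_ncard (fun P hP => ?_) (Set.toFinite _)
  by_contra hnot
  refine hP ?_
  rw [linearCombination_pgInd_apply]
  refine sum_eq_zero fun L hL => ?_
  have : ¬ P.1 ≤ L := fun h => hnot (mem_biUnion.2 ⟨L, hL, by simpa [A] using h⟩)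
  rw [pgInd, if_neg this, mul_zero]

/-- A combination of few lines has almost the maximal conceivable weight. -/
lemma le_pgWt_linearCombination (a : Submodule F (Fin 3 → F) →₀ ZMod p)
    (ha : ∀ L ∈ a.support, finrank F L = 2) :
    #a.support * (Fintype.card F + 2) ≤
      pgWt p F 2 (Finsupp.linearCombination (ZMod p) (pgInd p F 2) a) + #a.support ^ 2 := by
  have := Fintype.ofFinite (PGPoint F 2)
  let A : Submodule F (Fin 3 → F) → Finset (PGPoint F 2) := fun L => {P | P.1 ≤ L}
  let B : Submodule F (Fin 3 → F) → Finset (PGPoint F 2) := fun L =>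
    {P | P.1 ≤ L ∧ ∀ M ∈ a.support, P.1 ≤ M → M = L}
  have hB : ∀ L ∈ a.support, Fintype.card F + 2 ≤ #(B L) + #a.support := by
    intro L hL
    have h1 : #(A L) = Fintype.card F + 1 := by
      rw [← card_points_on_line (ha L hL), ← Set.ncard_coe_finset]
      simp [A]
    have h2 : A L ⊆ B L ∪ (a.support.erase L).biUnion fun M => A L ∩ A M := by
      intro P hP
      by_contra hnot
      simp only [A, B, mem_union, mem_filter, mem_univ, true_and, mem_biUnion, mem_inter,
        mem_erase, not_or, not_and, not_exists] at hP hnot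
      refine hnot.1 hP fun M hM hPM => ?_
      by_contra hML
      exact hnot.2 M ⟨hML, hM⟩ hP hPM
    have h3 : #((a.support.erase L).biUnion fun M => A L ∩ A M) ≤ #(a.support.erase L) * 1 := by
      refine card_biUnion_le_card_mul _ _ _ fun M hM => card_le_one.2 fun P hP Q hQ => ?_
      simp only [A, mem_inter, mem_filter, mem_univ, true_and] at hP hQ
      obtain ⟨hML, hM⟩ := mem_erase.1 hM
      exact PGPoint.eq_of_le_lines (ha L hL) (ha M hM) hML.symm hP.1 hP.2 hQ.1 hQ.2
    have h4 := (card_le_card h2).trans (card_union_le _ _)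
    have h5 := card_erase_add_one hL
    omega
  have hdisj : (a.support : Set (Submodule F (Fin 3 → F))).PairwiseDisjoint B := by
    intro L hL M hM hLM
    refine disjoint_left.2 fun P hP hP' => hLM ?_
    simp only [B, mem_filter, mem_univ, true_and] at hP hP'
    exact hP'.2 L hL hP.1
  have hsub : #(a.support.biUnion B) ≤
      pgWt p F 2 (Finsupp.linearCombination (ZMod p) (pgInd p F 2) a) := by
    rw [pgWt, ← Set.ncard_coe_finset]
    refine Set.ncard_le_ncard (fun P hP => ?_) (Set.toFinite _)
    obtain ⟨L, hL, hPL⟩ := mem_biUnion.1 (mem_coe.1 hP)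
    simp only [B, mem_filter, mem_univ, true_and] at hPL
    change Finsupp.linearCombination (ZMod p) (pgInd p F 2) a P ≠ 0
    rw [linearCombination_pgInd_apply, sum_eq_single_of_mem L hL, pgInd, if_pos hPL.1, mul_one]
    · exact Finsupp.mem_support_iff.1 hL
    · intro M hM hML
      rw [pgInd, if_neg fun h => hML (hPL.2 M hM h), mul_zero]
  rw [card_biUnion hdisj] at hsub
  calc #a.support * (Fintype.card F + 2) = ∑ L ∈ a.support, (Fintype.card F + 2) := by
        rw [sum_const, smul_eq_mul]
    _ ≤ ∑ L ∈ a.support, (#(B L) + #a.support) := sum_le_sum hB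
    _ = ∑ L ∈ a.support, #(B L) + #a.support ^ 2 := by
        rw [sum_add_distrib, sum_const, smul_eq_mul, sq]
    _ ≤ _ := Nat.add_le_add_right hsub _

/-- The weight of a combination of at most `√q` lines determines the number of lines. -/
lemma pred_card_mul_lt_pgWt (a : Submodule F (Fin 3 → F) →₀ ZMod p)
    (ha : ∀ L ∈ a.support, finrank F L = 2) {m : ℕ} (hm : #a.support = m + 1)
    (hq : (m + 1) ^ 2 ≤ Fintype.card F) :
    m * (Fintype.card F + 1) <
      pgWt p F 2 (Finsupp.linearCombination (ZMod p) (pgInd p F 2) a) := by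
  have := le_pgWt_linearCombination a ha
  rw [hm] at this
  nlinarith

theorem exists_linearCombination_of_pgWt_le [Fact p.Prime] [CharP F p] {k : ℕ}
    (hk : (k + 1) ^ 2 ≤ Fintype.card F) (hpk : p * k ≤ Fintype.card F)
    {c : PGPoint F 2 → ZMod p} (hc : c ∈ pgCode p F 2)
    (hwt : pgWt p F 2 c ≤ k * (Fintype.card F + 1)) :
    ∃ a : Submodule F (Fin 3 → F) →₀ ZMod p, (∀ L ∈ a.support, finrank F L = 2) ∧
      #a.support ≤ k ∧ Finsupp.linearCombination (ZMod p) (pgInd p F 2) a = c := by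
  induction hn : pgWt p F 2 c using Nat.strong_induction_on generalizing c with
  | _ n ih =>
    by_cases hc0 : c = 0
    · exact ⟨0, by simp, by simp, by simp [hc0]⟩
    obtain ⟨L, hL, hs⟩ := exists_line_pgSecant_large hc hc0 hk hwt
    obtain ⟨r, hr, hlt⟩ := exists_frequent_value hpk hs
    have hdrop := pgWt_sub_smul_pgInd_lt hL hs hr hlt
    obtain ⟨a, ha, hak, hac⟩ := ih _ (hn ▸ hdrop)
      (Submodule.sub_mem _ hc (Submodule.smul_mem _ r (Submodule.subset_span ⟨L, hL, rfl⟩)))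
      (hdrop.le.trans hwt) rfl
    have hsupp : (a + Finsupp.single L r).support ⊆ a.support ∪ {L} :=
      Finsupp.support_add.trans (union_subset_union_right Finsupp.support_single_subset)
    have hlin : ∀ M ∈ (a + Finsupp.single L r).support, finrank F M = 2 := by
      intro M hM
      rcases mem_union.1 (hsupp hM) with h | h
      · exact ha M h
      · rw [mem_singleton.1 h, hL]
    have hcomb : Finsupp.linearCombination (ZMod p) (pgInd p F 2) (a + Finsupp.single L r) = c := by
      rw [map_add, hac, Finsupp.linearCombination_single, sub_add_cancel]
    refine ⟨_, hlin, ?_, hcomb⟩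
    have hle : #(a + Finsupp.single L r).support ≤ k + 1 :=
      (card_le_card hsupp).trans ((card_union_le _ _).trans
        (by rw [card_singleton]; exact Nat.add_le_add_right hak 1))
    by_contra! hgt
    have := pred_card_mul_lt_pgWt _ hlin (le_antisymm hle hgt) hk
    rw [hcomb] at this
    omega

end Combination

lemma pgCeil_one_eq {q w m : ℕ} (hlow : 0 < m → (m - 1) * (q + 1) < w)
    (hup : w ≤ m * (q + 1)) : pgCeil q w 1 = m := by
  have hθ : pgTheta q 1 = (q : ℤ) + 1 := by
    rw [pgTheta, show ((1 : ℤ) + 1).toNat = 2 from rfl, Finset.sum_range_succ,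
      Finset.sum_range_one, pow_zero, pow_one, add_comm]
  have hceil : ⌈(w : ℚ) / ((pgTheta q 1 : ℤ) : ℚ)⌉ = (m : ℤ) := by
    have hq : (0 : ℚ) < (q : ℚ) + 1 := by positivity
    rw [hθ, Int.ceil_eq_iff]
    push_cast
    constructor
    · rw [lt_div_iff₀ hq]
      rcases m with _ | n
      · have : (0 : ℚ) ≤ w := Nat.cast_nonneg w
        push_cast
        linarith
      · have h := hlow n.succ_pos
        rw [Nat.add_sub_cancel] at h
        push_cast
        rw [add_sub_cancel_right]
        exact_mod_cast h
    · rw [div_le_iff₀ hq]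
      exact_mod_cast hup
  rw [pgCeil, hceil, Int.toNat_natCast]

/-- Both cases of the weight hypothesis bound the weight by `(⌊√q⌋ - 1)(q + 1)`. -/
lemma le_sqrt_sub_one_mul {p h w : ℕ} (hp : p.Prime)
    (hwt : (2 < h ∧ (w : ℤ) ≤ (⌊Real.sqrt ((p ^ h : ℕ) : ℝ)⌋ - 1) * (((p ^ h : ℕ) : ℤ) + 1)) ∨
      (h = 2 ∧ (w : ℤ) ≤ (⌊(p : ℝ) / 4⌋ - 1) * (((p ^ h : ℕ) : ℤ) + 1))) :
    w ≤ (Nat.sqrt (p ^ h) - 1) * (p ^ h + 1) := by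
  have hsqrt : 0 < Nat.sqrt (p ^ h) := Nat.sqrt_pos.2 (pow_pos hp.pos h)
  zify [show 1 ≤ Nat.sqrt (p ^ h) from hsqrt]
  rcases hwt with ⟨-, hw⟩ | ⟨rfl, hw⟩
  · rw [Real.floor_real_sqrt_eq_nat_sqrt] at hw
    exact_mod_cast hw
  · have hfloor : ⌊(p : ℝ) / 4⌋ ≤ (p : ℤ) := by
      rw [Int.floor_le_iff]
      have : (0 : ℝ) ≤ p := Nat.cast_nonneg p
      push_cast
      linarith
    rw [Nat.sqrt_eq']
    refine hw.trans ?_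
    push_cast
    exact mul_le_mul_of_nonneg_right (by linarith) (by positivity)

/-- Theorem (Szőnyi–Weiner): a codeword of `C_1(2,q)` of weight at most
`(⌊√q⌋−1)(q+1)` (when `h > 2`), resp. `(⌊p/4⌋−1)(q+1)` (when `h = 2`), is a linear
combination of exactly `⌈wt(c)/(q+1)⌉` different lines. -/
theorem statement_1 (p h : ℕ) (hp : p.Prime) (hh : 2 ≤ h) (hq27 : 27 < p ^ h)
    (F : Type) [Field F] [Fintype F] (hF : Fintype.card F = p ^ h)
    (c : PGPoint F 2 → ZMod p) (hc : c ∈ pgCode p F 2)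
    (hwt : (2 < h ∧ (pgWt p F 2 c : ℤ) ≤
              (⌊Real.sqrt ((p ^ h : ℕ) : ℝ)⌋ - 1) * (((p ^ h : ℕ) : ℤ) + 1)) ∨
           (h = 2 ∧ (pgWt p F 2 c : ℤ) ≤
              (⌊(p : ℝ) / 4⌋ - 1) * (((p ^ h : ℕ) : ℤ) + 1))) :
    ∃ (L : Fin (pgCeil (p ^ h) (pgWt p F 2 c) 1) → Submodule F (Fin 3 → F))
      (α : Fin (pgCeil (p ^ h) (pgWt p F 2 c) 1) → ZMod p),
      Function.Injective L ∧ (∀ i, finrank F (L i) = 2) ∧ (∀ i, α i ≠ 0) ∧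
      c = fun P => ∑ i, α i * pgInd p F 2 (L i) P := by
  have : Fact p.Prime := ⟨hp⟩
  have : CharP F p := charP_of_card_eq_prime_pow hF
  set q := p ^ h
  have hsqrt : Nat.sqrt q - 1 + 1 = Nat.sqrt q :=
    Nat.sub_add_cancel (Nat.sqrt_pos.2 (pow_pos hp.pos h))
  have hk : (Nat.sqrt q - 1 + 1) ^ 2 ≤ Fintype.card F := by
    rw [hsqrt, hF]
    exact Nat.sqrt_le' q
  have hpk : p * (Nat.sqrt q - 1) ≤ Fintype.card F := by
    have h1 : p ≤ Nat.sqrt q := Nat.le_sqrt'.2 (Nat.pow_le_pow_right hp.pos hh)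
    rw [hF]
    exact (Nat.mul_le_mul h1 (Nat.sub_le _ _)).trans (Nat.sqrt_le q)
  obtain ⟨a, ha, hak, hac⟩ := exists_linearCombination_of_pgWt_le hk hpk hc
    (hF.symm ▸ le_sqrt_sub_one_mul hp hwt)
  have hm : pgCeil q (pgWt p F 2 c) 1 = a.support.card := by
    refine pgCeil_one_eq (fun hpos => ?_) ?_
    · obtain ⟨m, hm⟩ := Nat.exists_eq_add_of_lt hpos
      rw [zero_add] at hm
      have hmq : (m + 1) ^ 2 ≤ Fintype.card F :=
        (Nat.pow_le_pow_left (by omega) 2).trans hk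
      have := pred_card_mul_lt_pgWt a ha hm hmq
      rwa [hac, hF, ← Nat.add_sub_cancel (n := m) (m := 1), ← hm] at this
    · have := pgWt_linearCombination_le a ha
      rwa [hac, hF] at this
  rw [hm]
  let e := a.support.equivFin.symm
  refine ⟨fun i => e i, fun i => a (e i), Subtype.val_injective.comp e.injective,
    fun i => ha _ (e i).2, fun i => Finsupp.mem_support_iff.1 (e i).2, ?_⟩
  funext P
  rw [← hac, linearCombination_pgInd_apply,
    Equiv.sum_comp e fun L : a.support => a L * pgInd p F 2 L P,
    Finset.sum_coe_sort a.support fun L => a L * pgInd p F 2 L P]
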